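/- Let (P, d, μ) be a metric measure space where μ is a σ-finite Borel regular measure such that every open ball has finite positive measure, and μ is doubling: there is a constant C_d ≥ 1 with μ(B(x,2r)) ≤ C_d μ(B(x,r)) for all x ∈ P, r > 0. Let p ∈ [1,∞). Then there are constants c, c' > 0, depending only on the doubling constant and p, such that for every μ-measurable u: c · (M_p u)*(t) ≤ A_p u*(t) ≤ c' · (M_p u)*(t) for all t ∈ (0, μ(P)), and (M_p u)*(t) = 0 for all t ≥ μ(P). -/

import Mathlib

open MeasureTheory
open scoped ENNReal NNReal

/-- The non-centered Hardy–Littlewood-type maximal operator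
`M_p u (x) = sup_{B ∋ x} ((1/μ B) ∫_B u^p dμ)^{1/p}`, the supremum being taken over
open balls containing `x`. -/
noncomputable def maximalFn {P : Type*} [PseudoMetricSpace P] [MeasurableSpace P]
    (μ : Measure P) (p : ℝ) (u : P → ℝ≥0∞) (x : P) : ℝ≥0∞ :=
  ⨆ (c : P) (r : ℝ) (_ : 0 < r) (_ : x ∈ Metric.ball c r),
    ((μ (Metric.ball c r))⁻¹ * ∫⁻ z in Metric.ball c r, u z ^ p ∂μ) ^ (1 / p)

/-- The decreasing rearrangement `u*(t) = inf {s : μ {|u| > s} ≤ t}` of `u` (given here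
for the modulus `u : P → [0,∞]` of a measurable function). -/
noncomputable def rearr {P : Type*} [MeasurableSpace P] (μ : Measure P)
    (u : P → ℝ≥0∞) (t : ℝ) : ℝ≥0∞ :=
  sInf {s : ℝ≥0∞ | μ {x | s < u x} ≤ ENNReal.ofReal t}

/-- The elementary maximal function `u**(t) = (1/t) ∫₀^t u*(s) ds`. -/
noncomputable def doubleStar {P : Type*} [MeasurableSpace P] (μ : Measure P)
    (u : P → ℝ≥0∞) (t : ℝ) : ℝ≥0∞ :=
  (ENNReal.ofReal t)⁻¹ * ∫⁻ s in Set.Ioo (0 : ℝ) t, rearr μ u s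

/-- The maximal average `A_p f (t) = ((1/t) ∫₀^t f(s)^p ds)^{1/p}`, which for a
nonincreasing `f : (0,∞) → [0,∞]` equals the non-centered maximal function `M_p f (t)`
on `(0,∞)` with Lebesgue measure. -/
noncomputable def Ap (p : ℝ) (f : ℝ → ℝ≥0∞) (t : ℝ) : ℝ≥0∞ :=
  ((ENNReal.ofReal t)⁻¹ * ∫⁻ s in Set.Ioo (0 : ℝ) t, f s ^ p) ^ (1 / p)

open Set Metric

section Rearrangement

variable {P : Type*} [MeasurableSpace P] {μ : Measure P}

/-- The infimum defining the decreasing rearrangement is attained. -/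
theorem rearr_le_iff {f : P → ℝ≥0∞} {t : ℝ} {s : ℝ≥0∞} :
    rearr μ f t ≤ s ↔ μ {x | s < f x} ≤ ENNReal.ofReal t := by
  refine ⟨fun h => ?_, fun h => sInf_le h⟩
  rcases eq_or_ne s ⊤ with rfl | hs
  · simp
  obtain ⟨a, ha_anti, ha_gt, ha_lim⟩ := exists_seq_strictAnti_tendsto' hs.lt_top
  have hset : {x | s < f x} = ⋃ n, {x | a n < f x} := by
    ext x
    simp only [mem_ofPred_eq, mem_iUnion]
    exact ⟨fun hx => (ha_lim.eventually (gt_mem_nhds hx)).exists,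
      fun ⟨n, hn⟩ => (ha_gt n).1.trans hn⟩
  have hmono : Monotone fun n => {x | a n < f x} :=
    fun m n hmn x (hx : a m < f x) => (ha_anti.antitone hmn).trans_lt hx
  rw [hset, hmono.measure_iUnion]
  refine iSup_le fun n => ?_
  obtain ⟨s', hs', hlt⟩ := sInf_lt_iff.1 (h.trans_lt (ha_gt n).1)
  exact (measure_mono fun x (hx : a n < f x) => hlt.trans hx).trans hs'

theorem lt_rearr_iff {f : P → ℝ≥0∞} {t : ℝ} {s : ℝ≥0∞} :
    s < rearr μ f t ↔ ENNReal.ofReal t < μ {x | s < f x} := by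
  rw [← not_le, rearr_le_iff, not_le]

theorem rearr_antitone (f : P → ℝ≥0∞) : Antitone (rearr μ f) := fun _ _ h =>
  rearr_le_iff.2 ((rearr_le_iff.1 le_rfl).trans (ENNReal.ofReal_le_ofReal h))

theorem rearr_mono_ae {f g : P → ℝ≥0∞} (h : ∀ᵐ x ∂μ, f x ≤ g x) (t : ℝ) :
    rearr μ f t ≤ rearr μ g t := by
  refine rearr_le_iff.2 (le_trans (measure_mono_ae ?_) (rearr_le_iff.1 (le_refl (rearr μ g t))))
  filter_upwards [h] with x hx hlt using lt_of_lt_of_le hlt hx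

theorem rearr_le_add_of_ae_le_add {f g : P → ℝ≥0∞} {a : ℝ≥0∞} (h : ∀ᵐ x ∂μ, f x ≤ g x + a)
    (t : ℝ) : rearr μ f t ≤ rearr μ g t + a := by
  refine rearr_le_iff.2 (le_trans (measure_mono_ae ?_) (rearr_le_iff.1 (le_refl (rearr μ g t))))
  filter_upwards [h] with x hx hlt
  exact lt_of_add_lt_add_right (lt_of_lt_of_le hlt hx)

theorem rearr_rpow (f : P → ℝ≥0∞) {q : ℝ} (hq : 0 < q) (t : ℝ) :
    rearr μ (fun x => f x ^ q) t = rearr μ f t ^ q := by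
  refine eq_of_forall_ge_iff fun s => ?_
  rw [rearr_le_iff, ← ENNReal.le_rpow_inv_iff hq, rearr_le_iff]
  simp only [← not_le, ENNReal.le_rpow_inv_iff hq]

theorem volume_Ioi_inter_ofReal_lt (a : ℝ≥0∞) :
    volume {s : ℝ | s ∈ Ioi 0 ∧ ENNReal.ofReal s < a} = a := by
  rcases eq_or_ne a ⊤ with rfl | ha
  · have : {s : ℝ | s ∈ Ioi 0 ∧ ENNReal.ofReal s < ⊤} = Ioi 0 := by ext; simp
    rw [this, Real.volume_Ioi]
  · have : {s : ℝ | s ∈ Ioi 0 ∧ ENNReal.ofReal s < a} = Ioo 0 a.toReal := by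
      ext s
      simp only [mem_Ioi, mem_ofPred_eq, mem_Ioo]
      exact and_congr_right fun hs => ENNReal.ofReal_lt_iff_lt_toReal hs.le ha
    rw [this, Real.volume_Ioo, sub_zero, ENNReal.ofReal_toReal ha]

/-- The layer cake formula for functions with values in `[0, ∞]`. -/
theorem lintegral_eq_lintegral_measure_ofReal_lt [SFinite μ] {f : P → ℝ≥0∞} (hf : Measurable f) :
    ∫⁻ x, f x ∂μ = ∫⁻ s in Ioi (0 : ℝ), μ {x | ENNReal.ofReal s < f x} := by
  have hmeas : MeasurableSet {q : P × ℝ | ENNReal.ofReal q.2 < f q.1} :=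
    measurableSet_lt (by fun_prop) (by fun_prop)
  have hinner (x : P) : f x = ∫⁻ s in Ioi (0 : ℝ),
      {q : P × ℝ | ENNReal.ofReal q.2 < f q.1}.indicator 1 (x, s) := by
    have hx : MeasurableSet {s : ℝ | ENNReal.ofReal s < f x} :=
      measurableSet_lt (by fun_prop) (by fun_prop)
    calc f x = volume {s : ℝ | s ∈ Ioi 0 ∧ ENNReal.ofReal s < f x} :=
          (volume_Ioi_inter_ofReal_lt _).symm
      _ = volume.restrict (Ioi 0) {s : ℝ | ENNReal.ofReal s < f x} := by
          rw [Measure.restrict_apply hx]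
          congr 1
          ext s
          exact and_comm
      _ = ∫⁻ s in Ioi (0 : ℝ), {s : ℝ | ENNReal.ofReal s < f x}.indicator 1 s :=
          (lintegral_indicator_one hx).symm
  have houter (s : ℝ) : μ {x | ENNReal.ofReal s < f x} =
      ∫⁻ x, {q : P × ℝ | ENNReal.ofReal q.2 < f q.1}.indicator 1 (x, s) ∂μ :=
    (lintegral_indicator_one (measurableSet_lt measurable_const hf)).symm
  simp_rw [houter]
  rw [lintegral_congr hinner]
  exact lintegral_lintegral_swap (measurable_one.indicator hmeas).aemeasurable

/-- A function and its decreasing rearrangement have the same integral. -/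
theorem lintegral_rearr [SFinite μ] {f : P → ℝ≥0∞} (hf : Measurable f) :
    ∫⁻ t in Ioi (0 : ℝ), rearr μ f t = ∫⁻ x, f x ∂μ := by
  have hm : Measurable (rearr μ f) := (rearr_antitone f).measurable
  rw [lintegral_eq_lintegral_measure_ofReal_lt hm, lintegral_eq_lintegral_measure_ofReal_lt hf]
  refine lintegral_congr fun s => ?_
  rw [Measure.restrict_apply (measurableSet_lt measurable_const hm),
    ← volume_Ioi_inter_ofReal_lt (μ {x | ENNReal.ofReal s < f x})]
  congr 1
  ext t
  simp only [mem_inter_iff, mem_ofPred_eq, lt_rearr_iff]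
  exact and_comm

/-- The part of `f` above the level `f*(t)` has integral at most `∫₀ᵗ f*`. -/
theorem lintegral_tsub_rearr_le [SFinite μ] {f : P → ℝ≥0∞} (hf : Measurable f) (t : ℝ) :
    ∫⁻ x, (f x - rearr μ f t) ∂μ ≤ ∫⁻ s in Ioo 0 t, rearr μ f s := by
  rw [← lintegral_rearr (f := fun x => f x - rearr μ f t) (hf.sub measurable_const),
    ← lintegral_indicator measurableSet_Ioi, ← lintegral_indicator measurableSet_Ioo]
  refine lintegral_mono fun s => ?_
  by_cases hs : 0 < s
  · rw [indicator_of_mem (mem_Ioi.2 hs)]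
    by_cases hst : s < t
    · rw [indicator_of_mem (mem_Ioo.2 ⟨hs, hst⟩)]
      exact rearr_mono_ae (.of_forall fun x => tsub_le_self) s
    · refine (rearr_le_iff.2 ?_).trans zero_le
      simp only [tsub_pos_iff_lt]
      exact (rearr_le_iff.1 le_rfl).trans (ENNReal.ofReal_le_ofReal (not_lt.1 hst))
  · simp [hs]

theorem mul_rearr_le_lintegral (f : P → ℝ≥0∞) (t : ℝ) :
    ENNReal.ofReal t * rearr μ f t ≤ ∫⁻ s in Ioo 0 t, rearr μ f s := by
  calc ENNReal.ofReal t * rearr μ f t = ∫⁻ _ in Ioo 0 t, rearr μ f t := by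
        simp [mul_comm]
    _ ≤ _ := setLIntegral_mono' measurableSet_Ioo fun s hs => rearr_antitone f hs.2.le

end Rearrangement

/-- Open balls have positive finite measure, and doubling the radius of a ball increases its
measure at most by the factor `C`. -/
structure IsBallDoubling {P : Type*} [PseudoMetricSpace P] [MeasurableSpace P] (μ : Measure P)
    (C : ℝ≥0) : Prop where
  ball_pos : ∀ (x : P) (r : ℝ), 0 < r → 0 < μ (ball x r)
  ball_lt_top : ∀ (x : P) (r : ℝ), 0 < r → μ (ball x r) < ⊤
  ball_two_mul_le : ∀ (x : P) (r : ℝ), 0 < r → μ (ball x (2 * r)) ≤ C * μ (ball x r)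

/-- The non-centered maximal function of averages over open balls. -/
noncomputable def maximalAverage {P : Type*} [PseudoMetricSpace P] [MeasurableSpace P]
    (μ : Measure P) (v : P → ℝ≥0∞) (x : P) : ℝ≥0∞ :=
  ⨆ (c : P) (r : ℝ) (_ : 0 < r) (_ : x ∈ ball c r), (μ (ball c r))⁻¹ * ∫⁻ z in ball c r, v z ∂μ

section Maximal

variable {P : Type*} [PseudoMetricSpace P] [MeasurableSpace P] {μ : Measure P}

theorem maximalFn_eq_maximalAverage_rpow {p : ℝ} (hp : 0 < p) (u : P → ℝ≥0∞) (x : P) :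
    maximalFn μ p u x = maximalAverage μ (fun z => u z ^ p) x ^ (1 / p) := by
  rw [← ENNReal.orderIsoRpow_apply (1 / p) (by positivity), maximalAverage]
  simp only [OrderIso.map_iSup, ENNReal.orderIsoRpow_apply]
  rfl

theorem average_le_maximalAverage (v : P → ℝ≥0∞) {x c : P} {r : ℝ} (hr : 0 < r)
    (hx : x ∈ ball c r) :
    (μ (ball c r))⁻¹ * ∫⁻ z in ball c r, v z ∂μ ≤ maximalAverage μ v x :=
  le_iSup₂_of_le c r (le_iSup₂_of_le hr hx le_rfl)

theorem lt_maximalAverage_iff {v : P → ℝ≥0∞} {x : P} {s : ℝ≥0∞} :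
    s < maximalAverage μ v x ↔ ∃ c r, 0 < r ∧ x ∈ ball c r ∧
      s < (μ (ball c r))⁻¹ * ∫⁻ z in ball c r, v z ∂μ := by
  simp only [maximalAverage, lt_iSup_iff, exists_prop]

theorem isOpen_lt_maximalAverage (v : P → ℝ≥0∞) (s : ℝ≥0∞) :
    IsOpen {x | s < maximalAverage μ v x} := by
  refine isOpen_iff_mem_nhds.2 fun x hx => ?_
  obtain ⟨c, r, hr, hxc, hs⟩ := lt_maximalAverage_iff.1 hx
  filter_upwards [isOpen_ball.mem_nhds hxc] with y hy
  exact lt_maximalAverage_iff.2 ⟨c, r, hr, hy, hs⟩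

theorem maximalAverage_mono {v w : P → ℝ≥0∞} (h : v ≤ w) (x : P) :
    maximalAverage μ v x ≤ maximalAverage μ w x := by
  unfold maximalAverage
  gcongr
  exact h _

theorem maximalAverage_add_const_le (v : P → ℝ≥0∞) (a : ℝ≥0∞) (x : P) :
    maximalAverage μ (fun z => v z + a) x ≤ maximalAverage μ v x + a := by
  refine iSup₂_le fun c r => iSup₂_le fun hr hx => ?_
  rw [lintegral_add_right _ measurable_const, mul_add, setLIntegral_const]
  refine add_le_add (average_le_maximalAverage v hr hx) ?_
  rw [mul_left_comm]
  exact mul_le_of_le_one_right' (ENNReal.inv_mul_le_one _)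

namespace IsBallDoubling

variable {C : ℝ≥0}

theorem lintegral_ball_le (hμ : IsBallDoubling μ C) (v : P → ℝ≥0∞) {x c : P} {r : ℝ}
    (hr : 0 < r) (hx : x ∈ ball c r) :
    ∫⁻ z in ball c r, v z ∂μ ≤ maximalAverage μ v x * μ (ball c r) := by
  have h := average_le_maximalAverage (μ := μ) v hr hx
  rwa [mul_comm, ← div_eq_mul_inv, ENNReal.div_le_iff (hμ.ball_pos c r hr).ne'
    (hμ.ball_lt_top c r hr).ne] at h

theorem ball_eight_mul_le (hμ : IsBallDoubling μ C) (x : P) {r : ℝ} (hr : 0 < r) :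
    μ (ball x (8 * r)) ≤ C ^ 3 * μ (ball x r) := by
  calc μ (ball x (8 * r)) = μ (ball x (2 * (2 * (2 * r)))) := by ring_nf
    _ ≤ C * (C * (C * μ (ball x r))) := by
        grw [hμ.ball_two_mul_le x _ (by positivity), hμ.ball_two_mul_le x _ (by positivity),
          hμ.ball_two_mul_le x _ hr]
    _ = C ^ 3 * μ (ball x r) := by ring

theorem isUnifLocDoublingMeasure (hμ : IsBallDoubling μ C) : IsUnifLocDoublingMeasure μ := by
  refine ⟨C ^ 3, ?_⟩
  filter_upwards [self_mem_nhdsWithin] with ε (hε : 0 < ε) x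
  calc μ (closedBall x (2 * ε)) ≤ μ (ball x (8 * ε)) :=
        measure_mono (closedBall_subset_ball (by linarith))
    _ ≤ C ^ 3 * μ (ball x ε) := hμ.ball_eight_mul_le x hε
    _ ≤ (C ^ 3 : ℝ≥0) * μ (closedBall x ε) := by
        push_cast
        grw [measure_mono ball_subset_closedBall]

theorem secondCountableTopology [OpensMeasurableSpace P] [SFinite μ] (hμ : IsBallDoubling μ C) :
    SecondCountableTopology P := by
  refine secondCountable_of_almost_dense_set fun ε hε => ?_
  obtain ⟨T, -, hdisj, hcov⟩ := Vitali.exists_disjoint_subfamily_covering_enlargement_closedBall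
    (univ : Set P) id (fun _ => ε / 5) (ε / 5) (fun _ _ => le_rfl) 5 (by norm_num)
  refine ⟨T, ?_, fun x => ?_⟩
  · have h := Measure.countable_meas_pos_of_disjoint_iUnion (μ := μ)
      (As := fun i : T => closedBall (i : P) (ε / 5)) (fun _ => measurableSet_closedBall)
      (fun i j hij => hdisj i.2 j.2 (Subtype.coe_injective.ne hij))
    have huniv : {i : T | 0 < μ (closedBall (i : P) (ε / 5))} = univ :=
      eq_univ_of_forall fun i =>
        (hμ.ball_pos i (ε / 5) (by positivity)).trans_le (measure_mono ball_subset_closedBall)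
    rw [huniv, countable_univ_iff] at h
    exact h
  · obtain ⟨b, hb, hsub⟩ := hcov x (mem_univ x)
    refine ⟨b, hb, ?_⟩
    have hx := mem_closedBall.1 (hsub (mem_closedBall_self (by positivity)))
    simp only [id] at hx
    linarith

end IsBallDoubling

/-- If one measure of the enlarged balls is controlled by another measure of the balls, then the
same is true of the measures of the union of the balls. -/
theorem measure_biUnion_ball_le_of_enlargement [SecondCountableTopology P] [BorelSpace P]
    {ι : Type*} (S : Set ι) (c : ι → P) (r : ι → ℝ) (hr : ∀ a ∈ S, 0 < r a) (ν ρ : Measure P)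
    (K : ℝ≥0∞) (h : ∀ a ∈ S, ν (ball (c a) (8 * r a)) ≤ K * ρ (ball (c a) (r a))) :
    ν (⋃ a ∈ S, ball (c a) (r a)) ≤ K * ρ (⋃ a ∈ S, ball (c a) (r a)) := by
  have hUnion : ⋃ a ∈ S, ball (c a) (r a) =
      ⋃ n : ℕ, ⋃ a ∈ {a ∈ S | r a ≤ n}, ball (c a) (r a) := by
    ext x
    simp only [mem_iUnion, mem_ofPred_eq, exists_prop]
    constructor
    · rintro ⟨a, ha, hx⟩
      obtain ⟨n, hn⟩ := exists_nat_ge (r a)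
      exact ⟨n, a, ⟨ha, hn⟩, hx⟩
    · rintro ⟨n, a, ⟨ha, -⟩, hx⟩
      exact ⟨a, ha, hx⟩
  have hmono : Monotone fun n : ℕ => ⋃ a ∈ {a ∈ S | r a ≤ n}, ball (c a) (r a) :=
    fun m n hmn => biUnion_subset_biUnion_left fun a ha =>
      ⟨ha.1, ha.2.trans (Nat.cast_le.2 hmn)⟩
  conv_lhs => rw [hUnion]
  rw [hmono.measure_iUnion]
  refine iSup_le fun n => ?_
  obtain ⟨T, hTS, hdisj, hcov⟩ := Vitali.exists_disjoint_subfamily_covering_enlargement_closedBall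
    {a ∈ S | r a ≤ n} c r n (fun a ha => ha.2) 5 (by norm_num)
  have hdisj' : T.PairwiseDisjoint fun a => ball (c a) (r a) :=
    hdisj.mono fun a => ball_subset_closedBall
  have hT : T.Countable := hdisj'.countable_of_isOpen (fun _ _ => isOpen_ball)
    fun a ha => nonempty_ball.2 (hr a (hTS ha).1)
  calc ν (⋃ a ∈ {a ∈ S | r a ≤ n}, ball (c a) (r a))
      ≤ ν (⋃ b ∈ T, ball (c b) (8 * r b)) := by
        refine measure_mono (iUnion₂_subset fun a ha => ?_)
        obtain ⟨b, hb, hsub⟩ := hcov a ha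
        have hrb := hr b (hTS hb).1
        exact (ball_subset_closedBall.trans hsub).trans
          ((closedBall_subset_ball (by linarith)).trans
            (subset_biUnion_of_mem (u := fun b => ball (c b) (8 * r b)) hb))
    _ ≤ ∑' b : T, ν (ball (c b) (8 * r b)) := measure_biUnion_le ν hT _
    _ ≤ ∑' b : T, K * ρ (ball (c b) (r b)) := ENNReal.tsum_le_tsum fun b => h b (hTS b.2).1
    _ = K * ρ (⋃ b ∈ T, ball (c b) (r b)) := by
        rw [ENNReal.tsum_mul_left, measure_biUnion hT hdisj' fun _ _ => measurableSet_ball]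
    _ ≤ K * ρ (⋃ a ∈ S, ball (c a) (r a)) := by
        gcongr K * ρ ?_
        exact biUnion_subset_biUnion_left fun a ha => (hTS ha).1

namespace IsBallDoubling

variable {C : ℝ≥0} [SecondCountableTopology P] [BorelSpace P]

/-- The weak type `(1, 1)` bound for the non-centered maximal function. -/
theorem mul_measure_lt_maximalAverage_le (hμ : IsBallDoubling μ C) (g : P → ℝ≥0∞) (s : ℝ≥0∞) :
    s * μ {x | s < maximalAverage μ g x} ≤ C ^ 3 * ∫⁻ x, g x ∂μ := by
  set S : Set (P × ℝ) := {q | 0 < q.2 ∧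
    s < (μ (ball q.1 q.2))⁻¹ * ∫⁻ z in ball q.1 q.2, g z ∂μ}
  have hset : {x | s < maximalAverage μ g x} = ⋃ q ∈ S, ball q.1 q.2 := by
    ext x
    simp only [mem_ofPred_eq, lt_maximalAverage_iff, mem_iUnion, exists_prop, Prod.exists, S]
    grind
  have h := measure_biUnion_ball_le_of_enlargement S Prod.fst Prod.snd (fun q hq => hq.1)
    (s • μ) (μ.withDensity g) (C ^ 3) fun q hq => by
      have hs : s * μ (ball q.1 q.2) ≤ ∫⁻ z in ball q.1 q.2, g z ∂μ := by
        have h := hq.2.le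
        rwa [mul_comm, ← div_eq_mul_inv, ENNReal.le_div_iff_mul_le
          (.inl (hμ.ball_pos q.1 q.2 hq.1).ne') (.inl (hμ.ball_lt_top q.1 q.2 hq.1).ne)] at h
      rw [withDensity_apply _ measurableSet_ball, Measure.smul_apply, smul_eq_mul]
      calc s * μ (ball q.1 (8 * q.2)) ≤ s * (C ^ 3 * μ (ball q.1 q.2)) := by
            grw [hμ.ball_eight_mul_le q.1 hq.1]
        _ = C ^ 3 * (s * μ (ball q.1 q.2)) := by ring
        _ ≤ _ := by grw [hs]
  rw [← hset, Measure.smul_apply, smul_eq_mul,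
    withDensity_apply _ (isOpen_lt_maximalAverage g s).measurableSet] at h
  exact h.trans (mul_le_mul_right (setLIntegral_le_lintegral _ _) _)

/-- The integral of `v` over a proper superlevel set of its maximal function, estimated through
a covering by balls whose radii are the distances to the complement. -/
theorem lintegral_lt_maximalAverage_le (hμ : IsBallDoubling μ C) (v : P → ℝ≥0∞) {s : ℝ≥0∞}
    (hne : {x | s < maximalAverage μ v x} ≠ univ) :
    ∫⁻ x in {x | s < maximalAverage μ v x}, v x ∂μ ≤
      C ^ 3 * s * μ {x | s < maximalAverage μ v x} := by
  set E := {x | s < maximalAverage μ v x}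
  have hE : IsOpen E := isOpen_lt_maximalAverage v s
  have hF : Eᶜ.Nonempty := nonempty_compl.2 hne
  have hpos : ∀ x ∈ E, 0 < infDist x Eᶜ := fun x hx => by
    refine (infDist_pos_iff_notMem_closure hF).1 ?_
    rw [hE.isClosed_compl.closure_eq]
    exact not_not.2 hx
  have hset : ⋃ x ∈ E, ball x (infDist x Eᶜ) = E :=
    Subset.antisymm (iUnion₂_subset fun x _ => ball_infDist_compl_subset)
      fun x hx => mem_biUnion hx (mem_ball_self (hpos x hx))
  have h := measure_biUnion_ball_le_of_enlargement E id (fun x => infDist x Eᶜ) hpos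
    (μ.withDensity v) μ (C ^ 3 * s) fun x hx => by
      have hx0 := hpos x hx
      obtain ⟨y, hy, hxy⟩ := (infDist_lt_iff hF).1
        (show infDist x Eᶜ < 8 * infDist x Eᶜ by linarith)
      rw [withDensity_apply _ measurableSet_ball]
      calc ∫⁻ z in ball x (8 * infDist x Eᶜ), v z ∂μ
          ≤ maximalAverage μ v y * μ (ball x (8 * infDist x Eᶜ)) :=
            hμ.lintegral_ball_le v (by positivity) (mem_ball'.2 hxy)
        _ ≤ s * (C ^ 3 * μ (ball x (infDist x Eᶜ))) := by
            grw [show maximalAverage μ v y ≤ s from not_lt.1 hy, hμ.ball_eight_mul_le x hx0]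
        _ = C ^ 3 * s * μ (ball x (infDist x Eᶜ)) := by ring
  simp only [id] at h
  rwa [hset, withDensity_apply _ hE.measurableSet] at h

/-- An integrable function is almost everywhere controlled by its maximal function. -/
theorem ae_le_mul_maximalAverage_of_lintegral_ne_top (hμ : IsBallDoubling μ C) {v : P → ℝ≥0∞}
    (hv : Measurable v) (hfin : ∫⁻ x, v x ∂μ ≠ ⊤) :
    ∀ᵐ x ∂μ, v x ≤ C * maximalAverage μ v x := by
  have : IsUnifLocDoublingMeasure μ := hμ.isUnifLocDoublingMeasure
  have : IsLocallyFiniteMeasure μ :=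
    ⟨fun x => ⟨ball x 1, ball_mem_nhds x one_pos, hμ.ball_lt_top x 1 one_pos⟩⟩
  filter_upwards [(IsUnifLocDoublingMeasure.vitaliFamily μ 1).ae_tendsto_lintegral_div'
    hv hfin] with x hx
  have hball := IsUnifLocDoublingMeasure.tendsto_closedBall_filterAt μ (K := 1) (x := x)
    (l := nhdsWithin (0 : ℝ) (Ioi 0)) (fun _ => x) id Filter.tendsto_id (by
      filter_upwards [self_mem_nhdsWithin] with r (hr : 0 < r)
      exact mem_closedBall_self (by simpa using hr.le))
  refine le_of_tendsto (hx.comp hball) ?_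
  filter_upwards [self_mem_nhdsWithin] with r (hr : 0 < r)
  simp only [Function.comp_apply, id]
  refine ENNReal.div_le_of_le_mul ?_
  calc ∫⁻ y in closedBall x r, v y ∂μ ≤ ∫⁻ y in ball x (2 * r), v y ∂μ :=
        lintegral_mono_set (closedBall_subset_ball (by linarith))
    _ ≤ maximalAverage μ v x * μ (ball x (2 * r)) :=
        hμ.lintegral_ball_le v (by positivity) (mem_ball_self (by positivity))
    _ ≤ maximalAverage μ v x * (C * μ (closedBall x r)) := by
        grw [hμ.ball_two_mul_le x r hr, measure_mono ball_subset_closedBall]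
    _ = C * maximalAverage μ v x * μ (closedBall x r) := by ring

/-- A locally integrable function is almost everywhere controlled by its maximal function. -/
theorem ae_le_mul_maximalAverage (hμ : IsBallDoubling μ C) {v : P → ℝ≥0∞} (hv : Measurable v)
    (hfin : ∀ (x : P) (r : ℝ), ∫⁻ z in ball x r, v z ∂μ ≠ ⊤) :
    ∀ᵐ x ∂μ, v x ≤ C * maximalAverage μ v x := by
  rcases isEmpty_or_nonempty P with hP | ⟨⟨o⟩⟩
  · exact .of_forall fun x => hP.elim x
  have h : ∀ᵐ x ∂μ, ∀ n : ℕ, (ball o n).indicator v x ≤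
      C * maximalAverage μ ((ball o n).indicator v) x :=
    ae_all_iff.2 fun n => hμ.ae_le_mul_maximalAverage_of_lintegral_ne_top
      (hv.indicator measurableSet_ball) (by
        rw [lintegral_indicator measurableSet_ball]
        exact hfin o n)
  filter_upwards [h] with x hx
  obtain ⟨n, hn⟩ := exists_nat_gt (dist x o)
  have hxn := hx n
  rw [indicator_of_mem (mem_ball.2 hn)] at hxn
  grw [hxn, maximalAverage_mono (indicator_le_self _ v) x]

/-- The upper bound for the rearrangement of the maximal function. -/
theorem rearr_maximalAverage_le [SFinite μ] (hμ : IsBallDoubling μ C) (hC : C ≠ 0) {v : P → ℝ≥0∞}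
    (hv : Measurable v) {t : ℝ} (ht : 0 < t) :
    rearr μ (maximalAverage μ v) t ≤ (C ^ 3 + 1) *
      ((ENNReal.ofReal t)⁻¹ * ∫⁻ s in Ioo 0 t, rearr μ v s) := by
  have ht0 : ENNReal.ofReal t ≠ 0 := (ENNReal.ofReal_pos.2 ht).ne'
  set I := ∫⁻ s in Ioo 0 t, rearr μ v s
  set l := rearr μ v t
  set a := (ENNReal.ofReal t)⁻¹ * I
  have hI : ENNReal.ofReal t * a = I := ENNReal.mul_inv_cancel_left ht0 ENNReal.ofReal_ne_top
  have hla : l ≤ a := by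
    have h : ENNReal.ofReal t * l ≤ I := mul_rearr_le_lintegral v t
    rwa [← hI, ENNReal.mul_le_mul_iff_right ht0 ENNReal.ofReal_ne_top] at h
  have hsplit (x : P) : maximalAverage μ v x ≤ maximalAverage μ (fun z => v z - l) x + l :=
    (maximalAverage_mono (fun z => le_tsub_add) x).trans (maximalAverage_add_const_le _ l x)
  have hC0 : (C : ℝ≥0∞) ^ 3 ≠ 0 := by simpa using hC
  have hCtop : (C : ℝ≥0∞) ^ 3 ≠ ⊤ := by simp
  have hweak : rearr μ (maximalAverage μ fun z => v z - l) t ≤ C ^ 3 * a := by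
    rw [← ENNReal.div_le_iff' hC0 hCtop]
    refine le_of_forall_gt_imp_ge_of_dense fun K haK => ?_
    rcases eq_or_ne K ⊤ with rfl | hK
    · exact le_top
    rw [ENNReal.div_le_iff' hC0 hCtop, rearr_le_iff,
      ← ENNReal.mul_le_mul_iff_right (mul_ne_zero hC0 (zero_le.trans_lt haK).ne')
        (ENNReal.mul_ne_top hCtop hK)]
    calc C ^ 3 * K * μ {x | C ^ 3 * K < maximalAverage μ (fun z => v z - l) x}
        ≤ C ^ 3 * ∫⁻ x, (v x - l) ∂μ := hμ.mul_measure_lt_maximalAverage_le _ _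
      _ ≤ C ^ 3 * (ENNReal.ofReal t * a) := by
          rw [hI]
          grw [lintegral_tsub_rearr_le hv t]
      _ ≤ C ^ 3 * (ENNReal.ofReal t * K) := by grw [haK]
      _ = C ^ 3 * K * ENNReal.ofReal t := by ring
  calc rearr μ (maximalAverage μ v) t
      ≤ rearr μ (maximalAverage μ fun z => v z - l) t + l :=
        rearr_le_add_of_ae_le_add (.of_forall hsplit) t
    _ ≤ C ^ 3 * a + a := add_le_add hweak hla
    _ = (C ^ 3 + 1) * a := by ring

/-- The lower bound for the rearrangement of the maximal function. -/
theorem le_rearr_maximalAverage [SFinite μ] (hμ : IsBallDoubling μ C) {v : P → ℝ≥0∞}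
    (hv : Measurable v) {t : ℝ} (ht : 0 < t) (htμ : ENNReal.ofReal t < μ univ) :
    (ENNReal.ofReal t)⁻¹ * ∫⁻ s in Ioo 0 t, rearr μ v s ≤
      (C ^ 3 + C + 1) * rearr μ (maximalAverage μ v) t := by
  have ht0 : ENNReal.ofReal t ≠ 0 := (ENNReal.ofReal_pos.2 ht).ne'
  set l := rearr μ (maximalAverage μ v) t
  rcases eq_or_ne l ⊤ with htop | htop
  · rw [htop, ENNReal.mul_top (by simp)]
    exact le_top
  set E := {x | l < maximalAverage μ v x}
  have hEt : μ E ≤ ENNReal.ofReal t := rearr_le_iff.1 le_rfl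
  have hEm : MeasurableSet E := (isOpen_lt_maximalAverage v l).measurableSet
  have hEne : E ≠ univ := fun h => (h ▸ hEt).not_gt htμ
  obtain ⟨y, hy⟩ := nonempty_compl.2 hEne
  have hyl : maximalAverage μ v y ≤ l := not_lt.1 hy
  have hfin (x : P) (r : ℝ) : ∫⁻ z in ball x r, v z ∂μ ≠ ⊤ := by
    have hr : 0 < max r (dist y x) + 1 := by positivity
    refine ((lintegral_mono_set (ball_subset_ball (le_max_left r (dist y x) |>.trans
      (lt_add_one _).le))).trans_lt ((hμ.lintegral_ball_le v hr (mem_ball.2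
        ((le_max_right _ _).trans_lt (lt_add_one _)))).trans_lt
          (ENNReal.mul_lt_top (hyl.trans_lt htop.lt_top) (hμ.ball_lt_top _ _ hr)))).ne
  have hle : ∀ᵐ x ∂μ, v x ≤ E.indicator v x + C * l := by
    filter_upwards [hμ.ae_le_mul_maximalAverage hv hfin] with x hx
    by_cases hxE : x ∈ E
    · rw [indicator_of_mem hxE]
      exact le_self_add
    · rw [indicator_of_notMem hxE, zero_add]
      grw [hx, show maximalAverage μ v x ≤ l from not_lt.1 hxE]
  have hint : ∫⁻ s in Ioo 0 t, rearr μ v s ≤ ENNReal.ofReal t * ((C ^ 3 + C) * l) :=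
    calc ∫⁻ s in Ioo 0 t, rearr μ v s
        ≤ ∫⁻ s in Ioo 0 t, (rearr μ (E.indicator v) s + C * l) :=
          lintegral_mono fun s => rearr_le_add_of_ae_le_add hle s
      _ = (∫⁻ s in Ioo 0 t, rearr μ (E.indicator v) s) + C * l * ENNReal.ofReal t := by
          rw [lintegral_add_right _ measurable_const]
          simp
      _ ≤ (∫⁻ s in Ioi 0, rearr μ (E.indicator v) s) + C * l * ENNReal.ofReal t := by
          gcongr
          exact Ioo_subset_Ioi_self
      _ = (∫⁻ x in E, v x ∂μ) + C * l * ENNReal.ofReal t := by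
          rw [lintegral_rearr (hv.indicator hEm), lintegral_indicator hEm]
      _ ≤ C ^ 3 * l * ENNReal.ofReal t + C * l * ENNReal.ofReal t := by
          grw [hμ.lintegral_lt_maximalAverage_le v hEne, hEt]
      _ = ENNReal.ofReal t * ((C ^ 3 + C) * l) := by ring
  grw [hint, ENNReal.inv_mul_cancel_left ht0 ENNReal.ofReal_ne_top]
  gcongr ?_ * _
  exact le_self_add

end IsBallDoubling

end Maximal

/-- **The Herz–Riesz inequality for `M_p`:** on any metric measure space with a σ-finite
Borel regular doubling measure giving balls finite positive measure and any `p ∈ [1,∞)`,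
there are constants `c, c' > 0` depending only on the doubling constant and `p` with
`c (M_p u)*(t) ≤ A_p u*(t) ≤ c' (M_p u)*(t)` for `t ∈ (0, μ(P))`, and `(M_p u)*(t) = 0`
for `t ≥ μ(P)`. -/
theorem herz_riesz_inequality (Cd : ℝ≥0) (hCd : 1 ≤ Cd) (p : ℝ) (hp : 1 ≤ p) :
    ∃ c c' : ℝ, 0 < c ∧ 0 < c' ∧
      ∀ (P : Type) [MetricSpace P] [MeasurableSpace P] [BorelSpace P]
        (μ : Measure P), SigmaFinite μ →
        (∀ (x : P) (r : ℝ), 0 < r →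
          0 < μ (Metric.ball x r) ∧ μ (Metric.ball x r) < ⊤) →
        (∀ (x : P) (r : ℝ), 0 < r →
          μ (Metric.ball x (2 * r)) ≤ (Cd : ℝ≥0∞) * μ (Metric.ball x r)) →
        ∀ u : P → ℝ≥0∞, Measurable u →
          (∀ t : ℝ, 0 < t → ENNReal.ofReal t < μ Set.univ →
            ENNReal.ofReal c * rearr μ (maximalFn μ p u) t ≤ Ap p (rearr μ u) t ∧
              Ap p (rearr μ u) t ≤ ENNReal.ofReal c' * rearr μ (maximalFn μ p u) t) ∧
          (∀ t : ℝ, μ Set.univ ≤ ENNReal.ofReal t → rearr μ (maximalFn μ p u) t = 0) := by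
  have hp0 : 0 < p := one_pos.trans_le hp
  have hC0 : Cd ≠ 0 := (one_pos.trans_le hCd).ne'
  have hA : (0 : ℝ) < Cd ^ 3 + 1 := by positivity
  have hB : (0 : ℝ) < Cd ^ 3 + Cd + 1 := by positivity
  refine ⟨((Cd ^ 3 + 1 : ℝ) ^ (1 / p))⁻¹, (Cd ^ 3 + Cd + 1 : ℝ) ^ (1 / p), by positivity,
    by positivity, ?_⟩
  intro P _ _ _ μ hσ hball hdouble u hu
  have hμ : IsBallDoubling μ Cd :=
    ⟨fun x r hr => (hball x r hr).1, fun x r hr => (hball x r hr).2, hdouble⟩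
  have : SecondCountableTopology P := hμ.secondCountableTopology
  refine ⟨fun t ht htμ => ?_, fun t ht => nonpos_iff_eq_zero.1 (rearr_le_iff.2 ?_)⟩
  · have hv : Measurable fun z => u z ^ p := hu.pow_const p
    have hM : rearr μ (maximalFn μ p u) t =
        rearr μ (maximalAverage μ fun z => u z ^ p) t ^ (1 / p) := by
      rw [funext (maximalFn_eq_maximalAverage_rpow hp0 u), rearr_rpow _ (by positivity)]
    have hAp : Ap p (rearr μ u) t =
        ((ENNReal.ofReal t)⁻¹ * ∫⁻ s in Ioo 0 t, rearr μ (fun z => u z ^ p) s) ^ (1 / p) := by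
      simp only [Ap, rearr_rpow u hp0]
    have hAe : ENNReal.ofReal (Cd ^ 3 + 1) = (Cd : ℝ≥0∞) ^ 3 + 1 := by
      rw [ENNReal.ofReal_add (by positivity) zero_le_one, ENNReal.ofReal_pow (by positivity)]
      simp
    have hBe : ENNReal.ofReal (Cd ^ 3 + Cd + 1) = (Cd : ℝ≥0∞) ^ 3 + Cd + 1 := by
      rw [ENNReal.ofReal_add (by positivity) zero_le_one,
        ENNReal.ofReal_add (by positivity) (by positivity), ENNReal.ofReal_pow (by positivity)]
      simp
    rw [hM, hAp]
    constructor
    · rw [ENNReal.ofReal_inv_of_pos (by positivity), mul_comm, ← div_eq_mul_inv,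
        ENNReal.div_le_iff' (ENNReal.ofReal_pos.2 (by positivity)).ne' ENNReal.ofReal_ne_top,
        ← ENNReal.ofReal_rpow_of_pos hA, ← ENNReal.mul_rpow_of_nonneg _ _ (by positivity), hAe]
      exact ENNReal.rpow_le_rpow (hμ.rearr_maximalAverage_le hC0 hv ht) (by positivity)
    · rw [← ENNReal.ofReal_rpow_of_pos hB, ← ENNReal.mul_rpow_of_nonneg _ _ (by positivity), hBe]
      exact ENNReal.rpow_le_rpow (hμ.le_rearr_maximalAverage hv ht htμ) (by positivity)
  · exact (measure_mono (subset_univ _)).trans ht
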